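/- Assume φ is strongly convex with constant θ > 0, i.e. ∇²φ(s,α) − θ·Id is positive semidefinite for all (s,α) ∈ W°. Then there exists δ > 0 such that whenever ‖g‖ ≤ δ and ‖u_d‖ ≤ δ, there exists a constant κ > 0 with ∇²j(s,α) − κ·Id positive semidefinite for all (s,α) ∈ W°. -/

import Mathlib

open scoped BigOperators
open Filter

noncomputable section

/-- Index set `ℤ^d \ {0}` of nonzero frequencies. -/
abbrev K (d : ℕ) : Type := {k : Fin d → ℤ // k ≠ 0}

/-- Euclidean norm `|k|` of a frequency `k ∈ ℤ^d \ {0}`. -/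
noncomputable def nrm {d : ℕ} (k : K d) : ℝ := Real.sqrt (∑ i : Fin d, ((k.1 i : ℝ)) ^ 2)

/-- Squared fractional Sobolev seminorm `|u|_s² = Σ_k |k|^{2s} |u_k|²`. -/
noncomputable def HnormSq {d : ℕ} (s : ℝ) (u : K d → ℂ) : ℝ :=
  ∑' k : K d, nrm k ^ (2 * s) * ‖u k‖ ^ 2

/-- `u ∈ ℓ²`, i.e. `‖u‖ = |u|_0 < ∞`. -/
def MemL2 {d : ℕ} (u : K d → ℂ) : Prop := Summable fun k : K d => ‖u k‖ ^ 2

/-- `|u|_s < ∞`. -/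
def MemHs {d : ℕ} (s : ℝ) (u : K d → ℂ) : Prop :=
  Summable fun k : K d => nrm k ^ (2 * s) * ‖u k‖ ^ 2

def mD (L : ℝ) (p : ℝ × ℝ) : ℝ := p.2 + Real.exp (2 * L * p.1)
def mM (L : ℝ) (p : ℝ × ℝ) : ℝ := p.2 / mD L p
def mS (L : ℝ) (p : ℝ × ℝ) : ℝ := -2 * L * p.2 * Real.exp (2 * L * p.1) / mD L p ^ 2
def mA (L : ℝ) (p : ℝ × ℝ) : ℝ := Real.exp (2 * L * p.1) / mD L p ^ 2
def mSS (L : ℝ) (p : ℝ × ℝ) : ℝ :=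
  -4 * L ^ 2 * p.2 * Real.exp (2 * L * p.1) * (p.2 - Real.exp (2 * L * p.1)) / mD L p ^ 3
def mSA (L : ℝ) (p : ℝ × ℝ) : ℝ :=
  -2 * L * Real.exp (2 * L * p.1) * (Real.exp (2 * L * p.1) - p.2) / mD L p ^ 3
def mAA (L : ℝ) (p : ℝ × ℝ) : ℝ := -2 * Real.exp (2 * L * p.1) / mD L p ^ 3

/-- the linear form with the given components -/
def lin (a b : ℝ) : ℝ × ℝ →L[ℝ] ℝ :=
  a • ContinuousLinearMap.fst ℝ ℝ ℝ + b • ContinuousLinearMap.snd ℝ ℝ ℝ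

lemma lin_apply (a b : ℝ) (v : ℝ × ℝ) : lin a b v = a * v.1 + b * v.2 := by simp [lin]

lemma norm_lin (a b : ℝ) : ‖lin a b‖ ≤ |a| + |b| := by
  refine ContinuousLinearMap.opNorm_le_bound _ (by positivity) fun v => ?_
  rw [lin_apply, add_mul]
  refine (norm_add_le _ _).trans ?_
  rw [norm_mul, norm_mul, Real.norm_eq_abs a, Real.norm_eq_abs b]
  gcongr
  · exact norm_fst_le v
  · exact norm_snd_le v

lemma hasD_exp (L : ℝ) (p : ℝ × ℝ) :
    HasFDerivAt (fun p : ℝ × ℝ => Real.exp (2 * L * p.1)) (lin (2 * L * Real.exp (2 * L * p.1)) 0) p := by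
  have h := ((hasFDerivAt_fst (𝕜 := ℝ) (p := p)).const_mul (2 * L)).exp
  refine h.congr_fderiv ?_
  ext <;> simp [lin_apply] <;> ring

lemma hasD_snd (p : ℝ × ℝ) : HasFDerivAt (fun p : ℝ × ℝ => p.2) (lin 0 1) p := by
  refine (hasFDerivAt_snd (𝕜 := ℝ) (p := p)).congr_fderiv ?_
  ext <;> simp [lin_apply]

lemma hasD_mD (L : ℝ) (p : ℝ × ℝ) :
    HasFDerivAt (mD L) (lin (2 * L * Real.exp (2 * L * p.1)) 1) p := by
  refine ((hasD_snd p).add (hasD_exp L p)).congr_fderiv ?_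
  ext <;> simp [lin_apply]

lemma mD_pos (L : ℝ) {p : ℝ × ℝ} (hp : 0 < p.2) : 0 < mD L p := by
  unfold mD; positivity

lemma hasD_inv (L : ℝ) {p : ℝ × ℝ} (hp : 0 < p.2) :
    HasFDerivAt (fun p => (mD L p)⁻¹) (-((mD L p) ^ 2)⁻¹ • (lin (2 * L * Real.exp (2 * L * p.1)) 1)) p := 
  (hasDerivAt_inv (mD_pos L hp).ne').comp_hasFDerivAt p (hasD_mD L p)

lemma hasD_mM (L : ℝ) {p : ℝ × ℝ} (hp : 0 < p.2) :
    HasFDerivAt (mM L) (lin (mS L p) (mA L p)) p := by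
  have h0 := (mD_pos L hp).ne'
  refine (((hasD_snd p).mul (hasD_inv L hp)).congr_fderiv ?_)
  ext <;> simp [lin_apply, mS, mA] <;> field_simp
  simp [mD]

lemma hasD_mS (L : ℝ) {p : ℝ × ℝ} (hp : 0 < p.2) :
    HasFDerivAt (mS L) (lin (mSS L p) (mSA L p)) p := by
  have h0 := (mD_pos L hp).ne'
  have h := (((hasD_snd p).const_mul (-2 * L)).mul (hasD_exp L p)).mul ((hasD_inv L hp).pow 2)
  have e : mS L = fun p => -2 * L * p.2 * Real.exp (2 * L * p.1) * ((mD L p)⁻¹)^2 := by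
    ext p; simp [mS, div_eq_mul_inv]
  rw [e]
  refine h.congr_fderiv ?_
  ext <;> simp [lin_apply, mSS, mSA] <;> field_simp <;> simp [mD] <;> ring

lemma hasD_mA (L : ℝ) {p : ℝ × ℝ} (hp : 0 < p.2) :
    HasFDerivAt (mA L) (lin (mSA L p) (mAA L p)) p := by
  have h0 := (mD_pos L hp).ne'
  have h := (hasD_exp L p).mul ((hasD_inv L hp).pow 2)
  have e : mA L = fun p => Real.exp (2 * L * p.1) * ((mD L p)⁻¹)^2 := by
    ext p; simp [mA, div_eq_mul_inv]
  rw [e]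
  refine h.congr_fderiv ?_
  ext <;> simp [lin_apply, mAA, mSA] <;> field_simp <;> simp [mD] <;> ring


lemma exp_bds {s₀ L : ℝ} {p : ℝ × ℝ} (hs₀ : 0 < s₀) (hL : 0 ≤ L) (hs : s₀ ≤ p.1) :
    L ≤ Real.exp (2 * L * p.1) / (2 * s₀) ∧ L ^ 2 ≤ Real.exp (2 * L * p.1) / (2 * s₀ ^ 2) := by
  have hx : 0 ≤ 2 * L * p.1 := by have := hs₀.trans_le hs; positivity
  have h := Real.quadratic_le_exp_of_nonneg hx
  have h1 : 2 * L * s₀ ≤ 2 * L * p.1 := by gcongr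
  have h2 : (2 * L * s₀) ^ 2 ≤ (2 * L * p.1) ^ 2 := by gcongr
  constructor
  · rw [le_div_iff₀ (by positivity)]; nlinarith
  · rw [le_div_iff₀ (by positivity)]; nlinarith

section bounds
variable {s₀ α₀ α₁ L : ℝ} {p : ℝ × ℝ}

lemma bd_mM (h1 : 0 < p.2) : |mM L p| ≤ 1 := by
  have hD := mD_pos L h1
  rw [mM, abs_div, abs_of_pos hD, abs_of_pos h1, div_le_one hD, mD]
  have := Real.exp_pos (2 * L * p.1); linarith

lemma bd_mA (hα₀ : 0 < α₀) (h1 : α₀ ≤ p.2) : |mA L p| ≤ 1 / α₀ := by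
  have hp := hα₀.trans_le h1
  have hD := mD_pos L hp
  have hy := Real.exp_pos (2 * L * p.1)
  rw [mA, abs_div, abs_of_pos hy, abs_of_pos (pow_pos hD 2), div_le_div_iff₀ (by positivity) hα₀]
  unfold mD at *
  nlinarith [mul_nonneg hy.le (sub_nonneg.2 h1), mul_pos hp hy, mul_pos hα₀ hy]

lemma bd_mAA (hα₀ : 0 < α₀) (h1 : α₀ ≤ p.2) : |mAA L p| ≤ 2 / α₀ ^ 2 := by
  have hp := hα₀.trans_le h1
  have hD := mD_pos L hp
  have hy := Real.exp_pos (2 * L * p.1)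
  have hyD : Real.exp (2 * L * p.1) ≤ mD L p := by unfold mD; linarith
  have haD : α₀ ≤ mD L p := by unfold mD; linarith
  rw [mAA, abs_div, abs_mul, abs_of_pos hy, abs_of_pos (pow_pos hD 3),
    div_le_div_iff₀ (by positivity) (by positivity)]
  norm_num
  calc 2 * Real.exp (2 * L * p.1) * α₀ ^ 2 ≤ 2 * mD L p * mD L p ^ 2 := by gcongr
    _ = _ := by ring

lemma bd_mS (hs₀ : 0 < s₀) (hα₀ : 0 < α₀) (hL : 0 ≤ L) (h0 : s₀ ≤ p.1) (h1 : α₀ ≤ p.2)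
    (h2 : p.2 ≤ α₁) : |mS L p| ≤ α₁ / s₀ := by
  have hp := hα₀.trans_le h1
  have hD := mD_pos L hp
  have hy := Real.exp_pos (2 * L * p.1)
  have hyD : Real.exp (2 * L * p.1) ≤ mD L p := by unfold mD; linarith
  obtain ⟨e1, e2⟩ := exp_bds hs₀ hL h0
  rw [mS, abs_div, abs_of_pos (pow_pos hD 2), div_le_iff₀ (by positivity), abs_mul, abs_mul,
    abs_mul, abs_of_pos hy, abs_of_pos hp, abs_of_nonneg hL]
  norm_num
  have h3 := hp.le.trans h2
  calc 2 * L * p.2 * Real.exp (2 * L * p.1)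
      ≤ 2 * (mD L p / (2 * s₀)) * α₁ * mD L p := by
        have : L ≤ mD L p / (2 * s₀) := e1.trans (by gcongr)
        gcongr
    _ = _ := by field_simp

lemma bd_mSA (hs₀ : 0 < s₀) (hα₀ : 0 < α₀) (hL : 0 ≤ L) (h0 : s₀ ≤ p.1) (h1 : α₀ ≤ p.2) :
    |mSA L p| ≤ 1 / s₀ := by
  have hp := hα₀.trans_le h1
  have hD := mD_pos L hp
  have hy := Real.exp_pos (2 * L * p.1)
  have hyD : Real.exp (2 * L * p.1) ≤ mD L p := by unfold mD; linarith
  have hyD' : |Real.exp (2 * L * p.1) - p.2| ≤ mD L p := by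
    unfold mD; rw [abs_le]; constructor <;> linarith
  obtain ⟨e1, e2⟩ := exp_bds hs₀ hL h0
  rw [mSA, abs_div, abs_of_pos (pow_pos hD 3), div_le_iff₀ (by positivity), abs_mul, abs_mul,
    abs_mul, abs_of_pos hy, abs_of_nonneg hL]
  norm_num
  calc 2 * L * Real.exp (2 * L * p.1) * |Real.exp (2 * L * p.1) - p.2|
      ≤ 2 * (mD L p / (2 * s₀)) * mD L p * mD L p := by
        have : L ≤ mD L p / (2 * s₀) := e1.trans (by gcongr)
        gcongr
    _ = _ := by field_simp

lemma bd_mSS (hs₀ : 0 < s₀) (hα₀ : 0 < α₀) (hL : 0 ≤ L) (h0 : s₀ ≤ p.1) (h1 : α₀ ≤ p.2)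
    (h2 : p.2 ≤ α₁) : |mSS L p| ≤ 2 * α₁ / s₀ ^ 2 := by
  have hp := hα₀.trans_le h1
  have hD := mD_pos L hp
  have hy := Real.exp_pos (2 * L * p.1)
  have hyD : Real.exp (2 * L * p.1) ≤ mD L p := by unfold mD; linarith
  have hyD' : |p.2 - Real.exp (2 * L * p.1)| ≤ mD L p := by
    unfold mD; rw [abs_le]; constructor <;> linarith
  obtain ⟨e1, e2⟩ := exp_bds hs₀ hL h0
  have h3 := hp.le.trans h2
  rw [mSS, abs_div, abs_of_pos (pow_pos hD 3), div_le_iff₀ (by positivity), abs_mul, abs_mul,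
    abs_mul, abs_mul, abs_of_pos hy, abs_of_pos hp, abs_of_nonneg (sq_nonneg L)]
  norm_num
  calc 4 * L ^ 2 * p.2 * Real.exp (2 * L * p.1) * |p.2 - Real.exp (2 * L * p.1)|
      ≤ 4 * (mD L p / (2 * s₀ ^ 2)) * α₁ * mD L p * mD L p := by
        have : L ^ 2 ≤ mD L p / (2 * s₀ ^ 2) := e2.trans (by gcongr)
        gcongr
    _ = _ := by field_simp; ring

end bounds

def mG (L : ℝ) (p : ℝ × ℝ) : ℝ × ℝ →L[ℝ] ℝ := lin (mS L p) (mA L p)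
def mH (L : ℝ) (p : ℝ × ℝ) : ℝ × ℝ →L[ℝ] ℝ × ℝ →L[ℝ] ℝ :=
  (lin (mSS L p) (mSA L p)).smulRight (lin 1 0) + (lin (mSA L p) (mAA L p)).smulRight (lin 0 1)

lemma hasD_mG (L : ℝ) {p : ℝ × ℝ} (hp : 0 < p.2) : HasFDerivAt (mG L) (mH L p) p := by
  have h := ((hasD_mS L hp).smul_const (lin 1 0)).add ((hasD_mA L hp).smul_const (lin 0 1))
  have e : mG L = fun p => mS L p • lin 1 0 + mA L p • lin 0 1 := by
    funext q; ext <;> simp [mG, lin_apply]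
  rw [e]; exact h

/-- A uniform bound for first and second derivatives. -/
lemma bd_all {s₀ α₀ α₁ : ℝ} (hs₀ : 0 < s₀) (hα₀ : 0 < α₀) (hα : α₀ < α₁) :
    ∃ C : ℝ, 1 ≤ C ∧ ∀ L : ℝ, 0 ≤ L → ∀ p : ℝ × ℝ, s₀ ≤ p.1 → α₀ ≤ p.2 → p.2 ≤ α₁ →
      ‖mG L p‖ ≤ C ∧ ‖mH L p‖ ≤ C := by
  have h3 : 0 < α₁ := hα₀.trans hα
  refine ⟨1 + (α₁ / s₀ + 1 / α₀) + ((2 * α₁ / s₀ ^ 2 + 1 / s₀) + (1 / s₀ + 2 / α₀ ^ 2)), ?_, ?_⟩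
  · have : 0 ≤ (α₁ / s₀ + 1 / α₀) + ((2 * α₁ / s₀ ^ 2 + 1 / s₀) + (1 / s₀ + 2 / α₀ ^ 2)) := by
      positivity
    linarith
  intro L hL p h0 h1 h2
  have b1 := bd_mS hs₀ hα₀ hL h0 h1 h2
  have b2 := bd_mA (L := L) hα₀ h1
  have b3 := bd_mSS hs₀ hα₀ hL h0 h1 h2
  have b4 := bd_mSA hs₀ hα₀ hL h0 h1
  have b5 := bd_mAA (L := L) hα₀ h1
  have n1 := norm_lin 1 0
  have n2 := norm_lin 0 1
  norm_num at n1 n2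
  have c1 : ‖mG L p‖ ≤ α₁ / s₀ + 1 / α₀ := (norm_lin _ _).trans (by linarith)
  have c2 : ‖mH L p‖ ≤ (2 * α₁ / s₀ ^ 2 + 1 / s₀) + (1 / s₀ + 2 / α₀ ^ 2) := by
    rw [mH]
    refine (norm_add_le (E := ℝ × ℝ →L[ℝ] ℝ × ℝ →L[ℝ] ℝ) _ _).trans ?_
    rw [ContinuousLinearMap.norm_smulRight_apply, ContinuousLinearMap.norm_smulRight_apply]
    refine add_le_add ?_ ?_
    · refine (mul_le_of_le_one_right (norm_nonneg _) n1).trans ((norm_lin _ _).trans (by linarith))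
    · refine (mul_le_of_le_one_right (norm_nonneg _) n2).trans ((norm_lin _ _).trans (by linarith))
  have q1 := (norm_nonneg (mG L p)).trans c1
  have q2 := (norm_nonneg (mH L p)).trans c2
  constructor <;> linarith

def tF (L a b c : ℝ) (p : ℝ × ℝ) : ℝ := a * mM L p ^ 2 - 2 * b * mM L p + c
def tG (L a b : ℝ) (p : ℝ × ℝ) : ℝ × ℝ →L[ℝ] ℝ := (2 * a * mM L p - 2 * b) • mG L p
def tH (L a b : ℝ) (p : ℝ × ℝ) : ℝ × ℝ →L[ℝ] ℝ × ℝ →L[ℝ] ℝ :=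
  (2 * a * mM L p - 2 * b) • mH L p + ((2 * a) • mG L p).smulRight (mG L p)

lemma hasD_tF (L a b c : ℝ) {p : ℝ × ℝ} (hp : 0 < p.2) :
    HasFDerivAt (tF L a b c) (tG L a b p) p := by
  have h : HasFDerivAt (mM L) (mG L p) p := hasD_mM L hp
  refine ((((h.pow 2).const_mul a).sub (h.const_mul (2 * b))).add_const c).congr_fderiv ?_
  ext <;> simp [tG] <;> ring

lemma hasD_tG (L a b : ℝ) {p : ℝ × ℝ} (hp : 0 < p.2) :
    HasFDerivAt (tG L a b) (tH L a b p) p := by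
  have h : HasFDerivAt (mM L) (mG L p) p := hasD_mM L hp
  exact ((h.const_mul (2 * a)).sub_const (2 * b)).smul (hasD_mG L hp)

lemma bd_t {L a b w C : ℝ} {p : ℝ × ℝ} (hp : 0 < p.2) (hC : 1 ≤ C) (ha : |a| ≤ w) (hb : 2 * |b| ≤ w)
    (hG : ‖mG L p‖ ≤ C) (hH : ‖mH L p‖ ≤ C) :
    ‖tG L a b p‖ ≤ 5 * C ^ 2 * w ∧ ‖tH L a b p‖ ≤ 5 * C ^ 2 * w := by
  have hw : 0 ≤ w := (abs_nonneg _).trans ha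
  have h1 : ‖2 * a * mM L p - 2 * b‖ ≤ 3 * w := by
    rw [Real.norm_eq_abs]
    refine (abs_sub _ _).trans ?_
    rw [abs_mul, abs_mul, abs_mul, abs_two]
    have : |a| * |mM L p| ≤ w * 1 := by
      have := bd_mM (L := L) hp
      gcongr
    nlinarith
  have hCC : C ≤ C ^ 2 := by nlinarith
  have e : 3 * w * C ≤ 3 * w * C ^ 2 := by gcongr
  have e' : 0 ≤ w * C ^ 2 := by positivity
  constructor
  · rw [tG, norm_smul]
    have : ‖2 * a * mM L p - 2 * b‖ * ‖mG L p‖ ≤ 3 * w * C := by gcongr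
    nlinarith
  · rw [tH]
    refine (norm_add_le (E := ℝ × ℝ →L[ℝ] ℝ × ℝ →L[ℝ] ℝ) _ _).trans ?_
    have h4 := ContinuousLinearMap.opNorm_smul_le (2 * a * mM L p - 2 * b) (mH L p)
    rw [ContinuousLinearMap.norm_smulRight_apply, norm_smul (2 * a) (mG L p),
      Real.norm_eq_abs (2 * a), abs_mul, abs_two]
    have h2 : ‖2 * a * mM L p - 2 * b‖ * ‖mH L p‖ ≤ 3 * w * C := by gcongr
    have h3 : 2 * |a| * ‖mG L p‖ * ‖mG L p‖ ≤ 2 * w * C * C := by gcongr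
    nlinarith

lemma one_le_nrm {d : ℕ} (k : K d) : 1 ≤ nrm k := by
  obtain ⟨i, hi⟩ : ∃ i, k.1 i ≠ 0 := by
    by_contra! h
    exact k.2 (funext h)
  rw [nrm, Real.one_le_sqrt]
  have h1 : (1 : ℝ) ≤ (k.1 i : ℝ) ^ 2 := by
    have : (1 : ℤ) ≤ (k.1 i) ^ 2 := by
      have := sq_pos_of_ne_zero hi
      omega
    exact_mod_cast this
  exact h1.trans (Finset.single_le_sum (f := fun i => (k.1 i : ℝ) ^ 2)
    (fun _ _ => sq_nonneg _) (Finset.mem_univ i))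

lemma term_eq {d : ℕ} (k : K d) (g u : ℂ) (p : ℝ × ℝ) :
    ‖(p.2 : ℂ) * g / ((p.2 + nrm k ^ (2 * p.1) : ℝ) : ℂ) - u‖ ^ 2 =
      tF (Real.log (nrm k)) (‖g‖ ^ 2) (g.re * u.re + g.im * u.im) (‖u‖ ^ 2) p := by
  have hn : 0 < nrm k := zero_lt_one.trans_le (one_le_nrm k)
  have e : p.2 + nrm k ^ (2 * p.1) = mD (Real.log (nrm k)) p := by
    rw [mD, Real.rpow_def_of_pos hn]; congr 2; ring
  have e2 : (p.2 : ℂ) * g / ((p.2 + nrm k ^ (2 * p.1) : ℝ) : ℂ) =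
      ((mM (Real.log (nrm k)) p : ℝ) : ℂ) * g := by
    rw [e, mM]; push_cast; ring
  rw [e2, tF, ← Complex.normSq_eq_norm_sq, ← Complex.normSq_eq_norm_sq, ← Complex.normSq_eq_norm_sq,
    Complex.normSq_apply, Complex.normSq_apply, Complex.normSq_apply]
  simp
  ring

lemma bd_ab (g u : ℂ) : |‖g‖ ^ 2| ≤ ‖g‖ ^ 2 + ‖u‖ ^ 2 ∧
    2 * |g.re * u.re + g.im * u.im| ≤ ‖g‖ ^ 2 + ‖u‖ ^ 2 := by
  constructor
  · rw [abs_of_nonneg (by positivity)]; nlinarith [sq_nonneg ‖u‖]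
  · rw [← Complex.normSq_eq_norm_sq, ← Complex.normSq_eq_norm_sq, Complex.normSq_apply,
      Complex.normSq_apply, ← abs_two, ← abs_mul, abs_le]
    constructor <;> nlinarith [sq_nonneg (g.re - u.re), sq_nonneg (g.re + u.re),
      sq_nonneg (g.im - u.im), sq_nonneg (g.im + u.im)]

/-- if `φ` is strongly convex with constant `θ > 0` on `W°`, then there is `δ > 0`
such that for any data `g, u_d ∈ ℓ²` with `‖g‖ ≤ δ` and `‖u_d‖ ≤ δ` there exists `κ > 0` with
`∇²j(s,α) ⪰ κ·Id` on all of `W°`. Positive semidefiniteness of `∇²f − c·Id` is expressed as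
`c‖v‖² ≤ (∇²f)(p)[v,v]` for all directions `v`. -/
theorem stmt_7 (d : ℕ) (hd : 1 ≤ d)
    (s₀ s₁ α₀ α₁ : ℝ) (hs₀ : 0 < s₀) (hs : s₀ < s₁) (hα₀ : 0 < α₀) (hα : α₀ < α₁)
    (W : Set (ℝ × ℝ)) (hW : W = Set.Ioo s₀ s₁ ×ˢ Set.Ioo α₀ α₁)
    (φ : ℝ × ℝ → ℝ) (hφC2 : ContDiffOn ℝ 2 φ W)
    (θ : ℝ) (hθ : 0 < θ)
    (hφsc : ∀ p ∈ W, ∀ v : ℝ × ℝ,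
      θ * ‖v‖ ^ 2 ≤ iteratedFDerivWithin ℝ 2 φ W p ![v, v]) :
    ∃ δ : ℝ, 0 < δ ∧
      ∀ g ud : K d → ℂ, MemL2 g → MemL2 ud →
        Real.sqrt (∑' k : K d, ‖g k‖ ^ 2) ≤ δ →
        Real.sqrt (∑' k : K d, ‖ud k‖ ^ 2) ≤ δ →
        ∀ j : ℝ × ℝ → ℝ,
          (∀ p : ℝ × ℝ, j p = (1 / (2 * (2 * Real.pi) ^ d)) *
              (∑' k : K d,
                ‖(p.2 : ℂ) * g k / ((p.2 + nrm k ^ (2 * p.1) : ℝ) : ℂ) - ud k‖ ^ 2)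
            + φ p) →
          ∃ κ : ℝ, 0 < κ ∧ ∀ p ∈ W, ∀ v : ℝ × ℝ,
            κ * ‖v‖ ^ 2 ≤ iteratedFDerivWithin ℝ 2 j W p ![v, v] := by
  obtain ⟨C, hC, hbd⟩ := bd_all hs₀ hα₀ hα
  have hWo : IsOpen W := by rw [hW]; exact isOpen_Ioo.prod isOpen_Ioo
  have hWc : IsPreconnected W := by
    rw [hW]; exact isPreconnected_Ioo.prod isPreconnected_Ioo
  have hmem : ∀ p ∈ W, s₀ ≤ p.1 ∧ α₀ ≤ p.2 ∧ p.2 ≤ α₁ ∧ 0 < p.2 := by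
    intro p hp
    rw [hW] at hp
    exact ⟨hp.1.1.le, hp.2.1.le, hp.2.2.le, hα₀.trans hp.2.1⟩
  have hCpos : 0 < C := zero_lt_one.trans_le hC
  refine ⟨Real.sqrt (θ / (20 * C ^ 2)), by positivity, ?_⟩
  intro g ud hg hud hgδ hudδ j hj
  refine ⟨θ / 2, by positivity, ?_⟩
  set c : ℝ := 1 / (2 * (2 * Real.pi) ^ d) with hc
  have hc0 : 0 ≤ c := by positivity
  have hc1 : c ≤ 1 := by
    rw [hc, div_le_one (by positivity)]
    have : (1 : ℝ) ≤ (2 * Real.pi) ^ d := one_le_pow₀ (by linarith [Real.pi_gt_three])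
    linarith
  set L : K d → ℝ := fun k => Real.log (nrm k) with hLdef
  have hL : ∀ k, 0 ≤ L k := fun k => Real.log_nonneg (one_le_nrm k)
  set a : K d → ℝ := fun k => ‖g k‖ ^ 2 with ha
  set b : K d → ℝ := fun k => (g k).re * (ud k).re + (g k).im * (ud k).im with hb
  set w : K d → ℝ := fun k => ‖g k‖ ^ 2 + ‖ud k‖ ^ 2 with hw
  have hws : Summable w := hg.add hud
  have hwsum : ∑' k, w k ≤ θ / (10 * C ^ 2) := by
    have e1 := (Real.sqrt_le_sqrt_iff (by positivity)).1 hgδ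
    have e2 := (Real.sqrt_le_sqrt_iff (by positivity)).1 hudδ
    have e3 : ∑' k, w k = _ := hg.tsum_add hud
    have e4 : θ / (10 * C ^ 2) = θ / (20 * C ^ 2) + θ / (20 * C ^ 2) := by field_simp; norm_num
    rw [e3, e4]; exact add_le_add e1 e2
  have hbt : ∀ k, ∀ p ∈ W, ‖tG (L k) (a k) (b k) p‖ ≤ 5 * C ^ 2 * w k ∧
      ‖tH (L k) (a k) (b k) p‖ ≤ 5 * C ^ 2 * w k := by
    intro k p hp
    obtain ⟨m1, m2, m3, m4⟩ := hmem p hp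
    obtain ⟨n1, n2⟩ := hbd (L k) (hL k) p m1 m2 m3
    exact bd_t m4 hC (bd_ab (g k) (ud k)).1 (bd_ab (g k) (ud k)).2 n1 n2
  have hu : Summable fun k => 5 * C ^ 2 * w k := hws.mul_left _
  set F : ℝ × ℝ → ℝ := fun p => ∑' k, tF (L k) (a k) (b k) (‖ud k‖ ^ 2) p with hF
  set G : ℝ × ℝ → (ℝ × ℝ →L[ℝ] ℝ) := fun p => ∑' k, tG (L k) (a k) (b k) p with hG
  set H : ℝ × ℝ → (ℝ × ℝ →L[ℝ] ℝ × ℝ →L[ℝ] ℝ) := fun p => ∑' k, tH (L k) (a k) (b k) p with hH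
  have hFG : ∀ p ∈ W, HasFDerivAt F (G p) p := by
    intro p hp
    refine hasFDerivAt_tsum_of_isPreconnected hu hWo hWc
      (fun k x hx => hasD_tF _ _ _ _ (hmem x hx).2.2.2) (fun k x hx => (hbt k x hx).1) hp ?_ hp
    refine Summable.of_norm_bounded (g := fun k => 4 * w k) (hws.mul_left 4) fun k => ?_
    have m1 := bd_mM (L := L k) (hmem p hp).2.2.2
    obtain ⟨q1, q2⟩ := bd_ab (g k) (ud k)
    have hu0 : 0 ≤ ‖ud k‖ ^ 2 := by positivity
    have hw0 : 0 ≤ w k := by positivity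
    have r1 : |a k * mM (L k) p ^ 2| ≤ w k * 1 := by
      rw [abs_mul, abs_pow (mM (L k) p)]
      refine mul_le_mul q1 (pow_le_one₀ (abs_nonneg _) m1) (by positivity) hw0
    have r2 : |2 * b k * mM (L k) p| ≤ w k * 1 := by
      rw [abs_mul, abs_mul, abs_two]
      exact mul_le_mul q2 m1 (abs_nonneg _) hw0
    have r3 : ‖ud k‖ ^ 2 ≤ w k := le_add_of_nonneg_left (by positivity)
    rw [Real.norm_eq_abs, tF]
    rw [abs_le] at *
    constructor <;> linarith
  have hGH : ∀ p ∈ W, HasFDerivAt G (H p) p := by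
    intro p hp
    refine hasFDerivAt_tsum_of_isPreconnected hu hWo hWc
      (fun k x hx => hasD_tG _ _ _ (hmem x hx).2.2.2) (fun k x hx => (hbt k x hx).2) hp ?_ hp
    exact Summable.of_norm_bounded hu fun k => (hbt k p hp).1
  have hHn : ∀ p ∈ W, ‖H p‖ ≤ θ / 2 := by
    intro p hp
    refine (tsum_of_norm_bounded (E := ℝ × ℝ →L[ℝ] ℝ × ℝ →L[ℝ] ℝ) hu.hasSum fun k => (hbt k p hp).2).trans ?_
    rw [tsum_mul_left]
    calc 5 * C ^ 2 * ∑' k, w k ≤ 5 * C ^ 2 * (θ / (10 * C ^ 2)) := by gcongr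
      _ = θ / 2 := by field_simp; norm_num
  have hjF : j = fun p => c * F p + φ p := by
    funext p
    rw [hj p]
    congr 2
    exact tsum_congr fun k => term_eq k (g k) (ud k) p
  intro p hp v
  have hφ1 : ∀ q ∈ W, HasFDerivAt φ (fderivWithin ℝ φ W q) q := fun q hq =>
    ((hφC2.differentiableOn (by norm_num) q hq).hasFDerivWithinAt).hasFDerivAt (hWo.mem_nhds hq)
  have hφ2 : HasFDerivWithinAt (fderivWithin ℝ φ W)
      (fderivWithin ℝ (fderivWithin ℝ φ W) W p) W p :=
    (((hφC2.fderivWithin hWo.uniqueDiffOn (m := 1) (by norm_num)).differentiableOn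
      (by norm_num)) p hp).hasFDerivWithinAt
  have hj1 : ∀ q ∈ W, fderivWithin ℝ j W q = c • G q + fderivWithin ℝ φ W q := by
    intro q hq
    rw [hjF]
    exact (((hFG q hq).const_mul c).add (hφ1 q hq)).hasFDerivWithinAt.fderivWithin
      (hWo.uniqueDiffWithinAt hq)
  have hj2 : fderivWithin ℝ (fderivWithin ℝ j W) W p =
      c • H p + fderivWithin ℝ (fderivWithin ℝ φ W) W p := by
    rw [fderivWithin_congr hj1 (hj1 p hp)]
    exact (((hGH p hp).hasFDerivWithinAt.const_smul c).add hφ2).fderivWithin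
      (hWo.uniqueDiffWithinAt hp)
  have key := hφsc p hp v
  rw [iteratedFDerivWithin_two_apply _ hWo.uniqueDiffOn hp] at key ⊢
  rw [hj2]
  simp only [Matrix.cons_val_zero, Matrix.cons_val_one, add_apply,
    smul_apply, smul_eq_mul] at key ⊢
  have hHv : |H p v v| ≤ θ / 2 * ‖v‖ ^ 2 := by
    have := (H p).le_opNorm₂ v v
    rw [Real.norm_eq_abs] at this
    refine this.trans ?_
    have := hHn p hp
    rw [mul_assoc, ← sq]
    gcongr
  have : |c * H p v v| ≤ θ / 2 * ‖v‖ ^ 2 := by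
    rw [abs_mul, abs_of_nonneg hc0]
    exact (mul_le_of_le_one_left (abs_nonneg _) hc1).trans hHv
  linarith [(abs_le.1 this).1]
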